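/- arXiv:2605.20943 — 4 statements merged into one kernel-verified Lean document; each statement's English description precedes it below -/
import Mathlib

section
/- Let G^m be an m-C-DMG over a partition of the substantive variables into nonempty clusters containing a cluster C with two distinct partially observed variables X1, X2 ∈ C, such that G^m contains a directed edge D → R_{X1} from some cluster vertex D but does not contain the directed edge D → R_{X2}. If there exists at least one variable-level m-ADMG compatible with G^m, then the inclusion of compatibility classes is strict: there exists a variable-level m-ADMG that is compatible with the associated cm-C-DMG π(G^m) but not compatible with G^m. -/
/-- Vertices of a variable-level missingness graph (m-ADMG): substantive
variables, missingness indicators, and proxy variables. -/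
inductive MVert (ι : Type) where
  | var (x : ι)
  | ind (x : ι)
  | proxy (x : ι)
  deriving DecidableEq

/-- A vertex "exists" in an m-ADMG with partially observed set `Vm`:
indicators and proxies only exist for partially observed variables. -/
def MVert.ok {ι : Type} (Vm : Set ι) : MVert ι → Prop
  | .var _ => True
  | .ind x => x ∈ Vm
  | .proxy x => x ∈ Vm

/-- A variable-level missingness graph (m-ADMG): an acyclic directed mixed graph
over substantive variables `ι`, with a missingness indicator and a proxy for each
partially observed variable (those in `Vm`).  Proxy vertices have no children and
no bidirected edges and have exactly the parents `var x` and `ind x`; missingness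
indicators have no self-loops, no edges between different indicators, and their
only children are their own proxies. -/
structure mADMG (ι : Type) where
  Vm : Set ι
  dir : MVert ι → MVert ι → Prop
  bi : MVert ι → MVert ι → Prop
  acyclic : ∀ v, ¬ Relation.TransGen dir v v
  bi_ne : ∀ u v, bi u v → u ≠ v
  mem_dir : ∀ u v, dir u v → u.ok Vm ∧ v.ok Vm
  mem_bi : ∀ u v, bi u v → u.ok Vm ∧ v.ok Vm
  proxy_no_children : ∀ (x : ι) (v : MVert ι), ¬ dir (.proxy x) v
  proxy_no_bi : ∀ (x : ι) (v : MVert ι), ¬ bi (.proxy x) v ∧ ¬ bi v (.proxy x)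
  proxy_parents : ∀ (x : ι) (v : MVert ι),
    dir v (.proxy x) ↔ (x ∈ Vm ∧ (v = .var x ∨ v = .ind x))
  ind_no_ind_dir : ∀ x y : ι, ¬ dir (.ind x) (.ind y)
  ind_no_ind_bi : ∀ x y : ι, ¬ bi (.ind x) (.ind y)
  ind_children : ∀ (x : ι) (v : MVert ι), dir (.ind x) v → v = .proxy x

/-- Vertices of an m-C-DMG: cluster vertices, variable-level missingness
indicators, and variable-level proxies. -/
inductive CVert (γ ι : Type) where
  | cl (c : γ)
  | ind (x : ι)
  | proxy (x : ι)
  deriving DecidableEq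

/-- Vertices of a cm-C-DMG: cluster vertices, cluster-level missingness
indicators, and variable-level proxies. -/
inductive CMVert (γ ι : Type) where
  | cl (c : γ)
  | rcl (c : γ)
  | proxy (x : ι)
  deriving DecidableEq

/-- An abstract m-C-DMG over clusters `γ` and substantive variables `ι`. -/
structure ClusterM (γ ι : Type) where
  Vm : Set ι
  dir : CVert γ ι → CVert γ ι → Prop
  bi : CVert γ ι → CVert γ ι → Prop

/-- An abstract cm-C-DMG over clusters `γ` and substantive variables `ι`. -/
structure ClusterCM (γ ι : Type) where
  Vm : Set ι
  dir : CMVert γ ι → CMVert γ ι → Prop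
  bi : CMVert γ ι → CMVert γ ι → Prop

variable {ι γ : Type}

/-- Directed edges of the m-C-DMG induced by an m-ADMG `G` and cluster map `κ`. -/
def inducedMdir (G : mADMG ι) (κ : ι → γ) : CVert γ ι → CVert γ ι → Prop
  | .cl c, .cl d => ∃ x y, κ x = c ∧ κ y = d ∧ G.dir (.var x) (.var y)
  | .cl c, .ind y => ∃ x, κ x = c ∧ G.dir (.var x) (.ind y)
  | .cl c, .proxy x => κ x = c ∧ x ∈ G.Vm
  | .ind x, .proxy y => x = y ∧ x ∈ G.Vm
  | _, _ => False

/-- Bidirected edges of the m-C-DMG induced by an m-ADMG `G` and cluster map `κ`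
(bidirected edges are unordered, so both recorded orientations are used). -/
def inducedMbi (G : mADMG ι) (κ : ι → γ) : CVert γ ι → CVert γ ι → Prop
  | .cl c, .cl d => ∃ x y, κ x = c ∧ κ y = d ∧
      (G.bi (.var x) (.var y) ∨ G.bi (.var y) (.var x))
  | .cl c, .ind y => ∃ x, κ x = c ∧ (G.bi (.var x) (.ind y) ∨ G.bi (.ind y) (.var x))
  | .ind y, .cl c => ∃ x, κ x = c ∧ (G.bi (.var x) (.ind y) ∨ G.bi (.ind y) (.var x))
  | _, _ => False

/-- The m-C-DMG induced by an m-ADMG `G` under the cluster map `κ`. -/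
def inducedM (G : mADMG ι) (κ : ι → γ) : ClusterM γ ι :=
  ⟨G.Vm, inducedMdir G κ, inducedMbi G κ⟩

/-- Directed edges of the cm-C-DMG induced by an m-ADMG `G` and cluster map `κ`. -/
def inducedCMdir (G : mADMG ι) (κ : ι → γ) : CMVert γ ι → CMVert γ ι → Prop
  | .cl c, .cl d => ∃ x y, κ x = c ∧ κ y = d ∧ G.dir (.var x) (.var y)
  | .cl c, .rcl d => ∃ x y, κ x = c ∧ κ y = d ∧ G.dir (.var x) (.ind y)
  | .cl c, .proxy x => κ x = c ∧ x ∈ G.Vm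
  | .rcl d, .proxy x => κ x = d ∧ x ∈ G.Vm
  | _, _ => False

/-- Bidirected edges of the cm-C-DMG induced by an m-ADMG `G` and cluster map `κ`. -/
def inducedCMbi (G : mADMG ι) (κ : ι → γ) : CMVert γ ι → CMVert γ ι → Prop
  | .cl c, .cl d => ∃ x y, κ x = c ∧ κ y = d ∧
      (G.bi (.var x) (.var y) ∨ G.bi (.var y) (.var x))
  | .cl c, .rcl d => ∃ x y, κ x = c ∧ κ y = d ∧
      (G.bi (.var x) (.ind y) ∨ G.bi (.ind y) (.var x))
  | .rcl d, .cl c => ∃ x y, κ x = c ∧ κ y = d ∧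
      (G.bi (.var x) (.ind y) ∨ G.bi (.ind y) (.var x))
  | _, _ => False

/-- The cm-C-DMG induced by an m-ADMG `G` under the cluster map `κ`. -/
def inducedCM (G : mADMG ι) (κ : ι → γ) : ClusterCM γ ι :=
  ⟨G.Vm, inducedCMdir G κ, inducedCMbi G κ⟩

/-- The vertex map underlying `π`: merge each variable-level missingness
indicator `R_X` into the cluster-level missingness vertex `R_{κ X}`. -/
def mergeVert (κ : ι → γ) : CVert γ ι → CMVert γ ι
  | .cl c => .cl c
  | .ind x => .rcl (κ x)
  | .proxy x => .proxy x

/-- The abstraction map `π` sending an m-C-DMG to its associated cm-C-DMG: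
within each cluster all missingness indicators are merged into a single
cluster-level missingness vertex, edges following along. -/
def piMap (κ : ι → γ) (H : ClusterM γ ι) : ClusterCM γ ι :=
  ⟨H.Vm,
   fun a b => ∃ u v, mergeVert κ u = a ∧ mergeVert κ v = b ∧ H.dir u v,
   fun a b => ∃ u v, mergeVert κ u = a ∧ mergeVert κ v = b ∧ H.bi u v⟩

/-- Adding one edge from a substantive variable to an indicator. -/
def addDir (G : mADMG ι) (x y : ι) (u v : MVert ι) : Prop :=
  G.dir u v ∨ (u = .var x ∧ v = .ind y)

def MVert.isVar : MVert ι → Prop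
  | .var _ => True
  | _ => False

theorem dir_isVar (G : mADMG ι) {u v : MVert ι} (h : G.dir u v) (hv : v.isVar) : u.isVar := by
  cases u with
  | var x => trivial
  | ind x => have := G.ind_children x v h; subst this; exact hv
  | proxy x => exact absurd h (G.proxy_no_children x v)

theorem transGen_isVar (G : mADMG ι) {u v : MVert ι} (h : Relation.TransGen G.dir u v)
    (hv : v.isVar) : u.isVar := by
  induction h using Relation.TransGen.head_induction_on with
  | single h => exact dir_isVar G h hv
  | head h _ ih => exact dir_isVar G h ih

theorem addDir_trans (G : mADMG ι) (x y : ι) {u v : MVert ι}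
    (h : Relation.TransGen (addDir G x y) u v) :
    (u.isVar ∧ ¬ v.isVar) ∨ Relation.TransGen G.dir u v := by
  induction h using Relation.TransGen.head_induction_on with
  | single h =>
    rcases h with h | ⟨rfl, rfl⟩
    · exact Or.inr (.single h)
    · exact Or.inl ⟨trivial, fun h => h⟩
  | head h _ ih =>
    rcases h with h | ⟨rfl, rfl⟩
    · rcases ih with ⟨h1, h2⟩ | ih
      · exact Or.inl ⟨dir_isVar G h h1, h2⟩
      · exact Or.inr (.head h ih)
    · rcases ih with ⟨h1, h2⟩ | ih
      · exact h1.elim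
      · exact Or.inl ⟨trivial, fun hv => transGen_isVar G ih hv⟩

/-- The m-ADMG with one added edge. -/
def addEdge (G : mADMG ι) (x y : ι) (hy : y ∈ G.Vm) : mADMG ι where
  Vm := G.Vm
  dir := addDir G x y
  bi := G.bi
  acyclic v h := by
    rcases addDir_trans G x y h with ⟨h1, h2⟩ | h
    · exact h2 h1
    · exact G.acyclic v h
  bi_ne := G.bi_ne
  mem_dir u v h := by
    rcases h with h | ⟨rfl, rfl⟩
    · exact G.mem_dir u v h
    · exact ⟨trivial, hy⟩
  mem_bi := G.mem_bi
  proxy_no_children z v h := by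
    rcases h with h | ⟨h, _⟩
    · exact G.proxy_no_children z v h
    · cases h
  proxy_no_bi := G.proxy_no_bi
  proxy_parents z v := by
    rw [← G.proxy_parents z v]
    simp [addDir]
  ind_no_ind_dir a b h := by
    rcases h with h | ⟨h, _⟩
    · exact G.ind_no_ind_dir a b h
    · cases h
  ind_no_ind_bi := G.ind_no_ind_bi
  ind_children a v h := by
    rcases h with h | ⟨h, _⟩
    · exact G.ind_children a v h
    · cases h

theorem inducedCM_eq_pi (G : mADMG ι) (κ : ι → γ) :
    inducedCM G κ = piMap κ (inducedM G κ) := by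
  unfold inducedCM piMap inducedM
  congr 1
  · funext a b
    apply propext
    constructor
    · intro h
      rcases a with c | c | z <;> rcases b with d | d | w <;> simp only [inducedCMdir] at h
      · exact ⟨.cl c, .cl d, rfl, rfl, h⟩
      · obtain ⟨x, y, hx, rfl, h⟩ := h
        exact ⟨.cl c, .ind y, rfl, rfl, x, hx, h⟩
      · exact ⟨.cl c, .proxy w, rfl, rfl, h⟩
      · obtain ⟨rfl, h⟩ := h
        exact ⟨.ind w, .proxy w, rfl, rfl, rfl, h⟩
    · rintro ⟨u, v, rfl, rfl, h⟩
      rcases u with c | c | z <;> rcases v with d | d | w <;> simp only [inducedMdir] at h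
      · exact h
      · obtain ⟨x, hx, h⟩ := h
        exact ⟨x, d, hx, rfl, h⟩
      · exact h
      · obtain ⟨rfl, h⟩ := h
        exact ⟨rfl, h⟩
  · funext a b
    apply propext
    constructor
    · intro h
      rcases a with c | c | z <;> rcases b with d | d | w <;> simp only [inducedCMbi] at h
      · exact ⟨.cl c, .cl d, rfl, rfl, h⟩
      · obtain ⟨x, y, hx, rfl, h⟩ := h
        exact ⟨.cl c, .ind y, rfl, rfl, x, hx, h⟩
      · obtain ⟨x, y, hx, rfl, h⟩ := h
        exact ⟨.ind y, .cl d, rfl, rfl, x, hx, h⟩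
    · rintro ⟨u, v, rfl, rfl, h⟩
      rcases u with c | c | z <;> rcases v with d | d | w <;> simp only [inducedMbi] at h
      · exact h
      · obtain ⟨x, hx, h⟩ := h
        exact ⟨x, d, hx, rfl, h⟩
      · obtain ⟨x, hx, h⟩ := h
        exact ⟨x, c, hx, rfl, h⟩

theorem inducedCM_addEdge (G : mADMG ι) (κ : ι → γ) (x y z : ι) (hy : y ∈ G.Vm)
    (hz : κ z = κ y) (h : G.dir (.var x) (.ind z)) :
    inducedCM (addEdge G x y hy) κ = inducedCM G κ := by
  have hd : inducedCMdir (addEdge G x y hy) κ = inducedCMdir G κ := by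
    funext a b
    rcases a with c | c | a <;> rcases b with d | d | b <;> try rfl
    · simp [inducedCMdir, addEdge, addDir]
    · apply propext
      constructor
      · rintro ⟨p, q, hp, hq, h' | ⟨h1, h2⟩⟩
        · exact ⟨p, q, hp, hq, h'⟩
        · cases h1; cases h2
          exact ⟨x, z, hp, hz.trans hq, h⟩
      · rintro ⟨p, q, hp, hq, h'⟩
        exact ⟨p, q, hp, hq, Or.inl h'⟩
  have hb : inducedCMbi (addEdge G x y hy) κ = inducedCMbi G κ := by
    funext a b
    rcases a with c | c | a <;> rcases b with d | d | b <;> rfl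
  unfold inducedCM
  rw [hd, hb]
  rfl

/-- Strictness of the inclusion of compatibility classes.
If an m-C-DMG `Gm` has a cluster containing two distinct partially observed
variables `X1 ≠ X2` whose missingness indicators are distinguished by `Gm`
(some cluster vertex `D` points to `R_{X1}` but not to `R_{X2}`), and some
m-ADMG is compatible with `Gm`, then there is an m-ADMG compatible with the
associated cm-C-DMG `π(Gm)` that is not compatible with `Gm`. -/
theorem compatibility_class_strict {ι γ : Type} (κ : ι → γ)
    (hκ : Function.Surjective κ) (Gm : ClusterM γ ι)
    (X1 X2 : ι) (hne : X1 ≠ X2) (h1 : X1 ∈ Gm.Vm) (h2 : X2 ∈ Gm.Vm)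
    (hsame : κ X1 = κ X2)
    (D : γ) (hD1 : Gm.dir (.cl D) (.ind X1)) (hD2 : ¬ Gm.dir (.cl D) (.ind X2))
    (hex : ∃ G : mADMG ι, inducedM G κ = Gm) :
    ∃ G' : mADMG ι, inducedCM G' κ = piMap κ Gm ∧ inducedM G' κ ≠ Gm := by
  obtain ⟨G, rfl⟩ := hex
  obtain ⟨x, hx, h⟩ := hD1
  refine ⟨addEdge G x X2 h2, ?_, ?_⟩
  · rw [inducedCM_addEdge G κ x X2 X1 h2 hsame h, inducedCM_eq_pi]
  · intro he
    apply hD2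
    rw [← he]
    exact ⟨x, hx, Or.inr ⟨rfl, rfl⟩⟩
end

section
/- Let G be a directed mixed graph and let w be a walk between distinct vertices u and v such that every intermediate occurrence on w is a collider, i.e., both edges of w adjacent to that occurrence have an arrowhead at it. Then there exists a path (a walk with no repeated vertices) between u and v in G such that every intermediate vertex of the path is a collider on the path. -/
/-- The kind of an edge traversed along a walk in a directed mixed graph:
`fwd` is a directed edge traversed from tail to head (arrowhead at the later
vertex), `bwd` is a directed edge traversed from head to tail (arrowhead at the
earlier vertex), and `bidir` is a bidirected edge (arrowheads at both ends). -/
inductive EKind where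
  | fwd
  | bwd
  | bidir
  deriving DecidableEq

/-- A walk from `u` to `v` in a directed mixed graph given by a directed-edge
relation `dir` and a (symmetrically interpreted) bidirected-edge relation `bi`:
a finite sequence of `n + 1` vertices together with, for each of the `n` steps,
the kind of edge used, where each edge joins the two vertices adjacent to it. -/
structure DWalk {V : Type} (dir bi : V → V → Prop) (u v : V) where
  n : ℕ
  vert : Fin (n + 1) → V
  first : vert 0 = u
  last : vert (Fin.last n) = v
  kind : Fin n → EKind
  valid : ∀ i : Fin n,
    (kind i = .fwd → dir (vert i.castSucc) (vert i.succ)) ∧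
    (kind i = .bwd → dir (vert i.succ) (vert i.castSucc)) ∧
    (kind i = .bidir →
      (bi (vert i.castSucc) (vert i.succ) ∨ bi (vert i.succ) (vert i.castSucc)))

/-- Every intermediate occurrence on the walk is a collider: for each position
`j` with `0 < j < n`, both the edge arriving at position `j` and the edge
leaving position `j` have an arrowhead at the vertex occurring there
(the arriving edge is not traversed head-to-tail, and the leaving edge is not
traversed tail-to-head). -/
def DWalk.AllColliders {V : Type} {dir bi : V → V → Prop} {u v : V}
    (w : DWalk dir bi u v) : Prop :=
  ∀ (j : ℕ) (_h0 : 0 < j) (hn : j < w.n),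
    w.kind ⟨j - 1, by omega⟩ ≠ EKind.bwd ∧ w.kind ⟨j, hn⟩ ≠ EKind.fwd

theorem DWalk.shorten {V : Type} {dir bi : V → V → Prop} {u v : V}
    (w : DWalk dir bi u v) (hw : w.AllColliders) (a d : ℕ) (hd : 0 < d) (had : a + d < w.n + 1)
    (he : w.vert ⟨a, by omega⟩ = w.vert ⟨a + d, had⟩) :
    ∃ p : DWalk dir bi u v, p.n < w.n ∧ p.AllColliders := by
  obtain ⟨n, vert, first, last, kind, valid⟩ := w
  simp only at had he
  obtain ⟨m, rfl⟩ : ∃ m, n = m + d := ⟨n - d, by omega⟩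
  let f : Fin (m + 1) → V := fun i =>
    if i.1 ≤ a then vert ⟨i.1, by omega⟩ else vert ⟨i.1 + d, by omega⟩
  let k : Fin m → EKind := fun i =>
    if i.1 < a then kind ⟨i.1, by omega⟩ else kind ⟨i.1 + d, by omega⟩
  have hf1 : ∀ i : Fin (m + 1), i.1 ≤ a → f i = vert ⟨i.1, by omega⟩ := by
    intro i hi
    simp only [f, if_pos hi]
  have hf2 : ∀ i : Fin (m + 1), a ≤ i.1 → f i = vert ⟨i.1 + d, by omega⟩ := by
    intro i hi
    rcases Nat.eq_or_lt_of_le hi with h | h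
    · rw [hf1 i h.ge]
      subst h
      exact he
    · simp only [f, if_neg (not_le.mpr h)]
  have hk1 : ∀ i : Fin m, i.1 < a → k i = kind ⟨i.1, by omega⟩ := by
    intro i hi
    simp only [k, if_pos hi]
  have hk2 : ∀ i : Fin m, a ≤ i.1 → k i = kind ⟨i.1 + d, by omega⟩ := by
    intro i hi
    simp only [k, if_neg (not_lt.mpr hi)]
  refine ⟨⟨m, f, ?_, ?_, k, ?_⟩, by simp only; omega, ?_⟩
  · rw [hf1 0 (by simp)]
    exact first
  · rw [hf2 (Fin.last m) (by simp only [Fin.val_last]; omega)]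
    exact last
  · intro i
    by_cases h : i.1 < a
    · rw [hk1 i h, hf1 i.castSucc (by simp only [Fin.val_castSucc]; omega),
        hf1 i.succ (by simp only [Fin.val_succ]; omega)]
      exact valid ⟨i.1, by omega⟩
    · rw [hk2 i (by omega), hf2 i.castSucc (by simp only [Fin.val_castSucc]; omega),
        hf2 i.succ (by simp only [Fin.val_succ]; omega)]
      have := valid ⟨i.1 + d, by omega⟩
      have e : (⟨i.succ.1 + d, by have := i.succ.2; omega⟩ : Fin (m + d + 1))
          = Fin.succ ⟨i.1 + d, by omega⟩ := by
        apply Fin.ext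
        simp only [Fin.val_succ]
        omega
      rw [e]
      exact this
  · intro j h0 hn
    simp only at hn
    constructor
    · show k ⟨j - 1, by omega⟩ ≠ _
      by_cases h : j - 1 < a
      · rw [hk1 _ h]
        exact (hw j h0 (by simp only; omega)).1
      · rw [hk2 _ (not_lt.mp h)]
        have := (hw (j + d) (by omega) (by simp only; omega)).1
        have e : j + d - 1 = j - 1 + d := by omega
        simpa only [e] using this
    · show k ⟨j, by omega⟩ ≠ _
      by_cases h : j < a
      · rw [hk1 _ h]
        exact (hw j h0 (by simp only; omega)).2
      · rw [hk2 _ (not_lt.mp h)]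
        exact (hw (j + d) (by omega) (by simp only; omega)).2

theorem DWalk.exists_path {V : Type} {dir bi : V → V → Prop} {u v : V} (N : ℕ) :
    ∀ w : DWalk dir bi u v, w.n = N → w.AllColliders →
    ∃ p : DWalk dir bi u v, Function.Injective p.vert ∧ p.AllColliders := by
  induction N using Nat.strong_induction_on with
  | _ N ih =>
    intro w hN hw
    by_cases hi : Function.Injective w.vert
    · exact ⟨w, hi, hw⟩
    · have key : ∃ x y, w.vert x = w.vert y ∧ x < y := by
        simp only [Function.Injective] at hi
        push Not at hi
        obtain ⟨x, y, h, hne⟩ := hi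
        rcases lt_or_gt_of_ne hne with h' | h'
        · exact ⟨x, y, h, h'⟩
        · exact ⟨y, x, h.symm, h'⟩
      obtain ⟨x, y, h, hlt⟩ := key
      have hlt' : x.1 < y.1 := hlt
      have e : x.1 + (y.1 - x.1) = y.1 := by omega
      obtain ⟨p, hp, hc⟩ := w.shorten hw x.1 (y.1 - x.1) (by omega) (by omega)
        (by simpa only [e] using h)
      exact ih p.n (by omega) p rfl hc

/-- In a directed mixed graph, if there is a walk between two
distinct vertices `u` and `v` on which every intermediate occurrence is a
collider, then there is a path (a walk with no repeated vertices) between `u`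
and `v` on which every intermediate vertex is a collider. -/
theorem collider_walk_to_collider_path {V : Type} (dir bi : V → V → Prop)
    (u v : V) (huv : u ≠ v) (w : DWalk dir bi u v) (hw : w.AllColliders) :
    ∃ p : DWalk dir bi u v, Function.Injective p.vert ∧ p.AllColliders := by
  exact DWalk.exists_path w.n w rfl hw
end

section
/- Let G^cm be a cm-C-DMG over a partition of the substantive variables into nonempty clusters, let C be a cluster containing at least one partially observed variable, and let R_C be its cluster-level missingness vertex. Assume there exists at least one variable-level m-ADMG compatible with G^cm. Then the following are equivalent: (i) G^cm contains a path between C and R_C all of whose intermediate vertices are colliders on the path and are cluster vertices; (ii) there exists a variable-level m-ADMG compatible with G^cm that contains a path between some partially observed variable X ∈ C and its missingness indicator R_X all of whose intermediate vertices are colliders on the path and are substantive variables. -/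
variable {ι γ : Type}

def NatW {V : Type} (dir bi : V → V → Prop) (P : V → Prop) (u v : V) (n : ℕ)
    (f : ℕ → V) (k : ℕ → EKind) : Prop :=
  f 0 = u ∧ f n = v ∧
  (∀ i, i < n → (k i = .fwd → dir (f i) (f (i+1))) ∧ (k i = .bwd → dir (f (i+1)) (f i)) ∧
    (k i = .bidir → (bi (f i) (f (i+1)) ∨ bi (f (i+1)) (f i)))) ∧
  (∀ j, 0 < j → j < n → k (j-1) ≠ .bwd ∧ k j ≠ .fwd ∧ P (f j))

theorem NatW.toInj {V : Type} {dir bi : V → V → Prop} {P : V → Prop} {u v : V} :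
    ∀ (n : ℕ) (f : ℕ → V) (k : ℕ → EKind), NatW dir bi P u v n f k →
    ∃ n f k, NatW dir bi P u v n f k ∧ ∀ i j, i < j → j ≤ n → f i ≠ f j := by
  intro n
  induction n using Nat.strong_induction_on with
  | _ n ih =>
    intro f k h
    by_cases hinj : ∀ i j, i < j → j ≤ n → f i ≠ f j
    · exact ⟨n, f, k, h, hinj⟩
    · push Not at hinj
      obtain ⟨i, j, hij, hjn, he⟩ := hinj
      obtain ⟨h1, h2, h3, h4⟩ := h
      refine ih (n - (j - i)) (by omega)
        (fun m => if m ≤ i then f m else f (m + (j - i)))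
        (fun m => if m < i then k m else k (m + (j - i))) ⟨?_, ?_, ?_, ?_⟩
      · simp [h1]
      · by_cases hj : j = n
        · have : n - (j - i) = i := by omega
          simp only [this, le_refl, if_true]
          rw [he, hj, h2]
        · have h5 : ¬ (n - (j - i) ≤ i) := by omega
          have h6 : n - (j - i) + (j - i) = n := by omega
          simp only [h5, if_false, h6, h2]
      · intro m hm
        rcases lt_trichotomy m i with hmi | hmi | hmi
        · have a1 : m ≤ i := by omega
          have a2 : m + 1 ≤ i := by omega
          simp only [a1, a2, hmi, if_true]
          exact h3 m (by omega)
        · have a2 : ¬ (m + 1 ≤ i) := by omega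
          have a3 : ¬ (m < i) := by omega
          have a1 : m ≤ i := by omega
          have a4 : m + (j - i) = j := by omega
          have a5 : m + 1 + (j - i) = j + 1 := by omega
          simp only [a1, a2, a3, if_true, if_false, a4, a5]
          rw [hmi, he]
          exact h3 j (by omega)
        · have a2 : ¬ (m + 1 ≤ i) := by omega
          have a3 : ¬ (m < i) := by omega
          have a1 : ¬ (m ≤ i) := by omega
          have a5 : m + 1 + (j - i) = m + (j - i) + 1 := by omega
          simp only [a1, a2, a3, if_false, a5]
          exact h3 _ (by omega)
      · intro m hm0 hm
        rcases lt_trichotomy m i with hmi | hmi | hmi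
        · have a1 : m ≤ i := by omega
          have a2 : m - 1 < i := by omega
          simp only [a1, a2, hmi, if_true]
          exact h4 m hm0 (by omega)
        · have a2 : m - 1 < i := by omega
          have a3 : ¬ (m < i) := by omega
          have a1 : m ≤ i := by omega
          have a4 : m + (j - i) = j := by omega
          simp only [a1, a2, a3, if_true, if_false, a4]
          exact ⟨(h4 m hm0 (by omega)).1, (h4 j (by omega) (by omega)).2.1,
            (h4 m hm0 (by omega)).2.2⟩
        · have a2 : ¬ (m - 1 < i) := by omega
          have a3 : ¬ (m < i) := by omega
          have a1 : ¬ (m ≤ i) := by omega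
          have a5 : m - 1 + (j - i) = m + (j - i) - 1 := by omega
          simp only [a1, a2, a3, if_false, a5]
          exact h4 _ (by omega) (by omega)

theorem NatW.ofD {V : Type} {dir bi : V → V → Prop} {P : V → Prop} {u v : V}
    (p : DWalk dir bi u v) (hc : p.AllColliders)
    (hP : ∀ (j : ℕ) (_h0 : 0 < j) (hn : j < p.n), P (p.vert ⟨j, Nat.lt_succ_of_lt hn⟩)) :
    ∃ f k, NatW dir bi P u v p.n f k ∧ ∀ i : Fin (p.n + 1), f i = p.vert i := by
  refine ⟨fun m => if h : m < p.n + 1 then p.vert ⟨m, h⟩ else u,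
    fun m => if h : m < p.n then p.kind ⟨m, h⟩ else .fwd, ⟨?_, ?_, ?_, ?_⟩, ?_⟩
  · simpa using p.first
  · refine (dif_pos (Nat.lt_succ_self _)).trans ?_
    exact p.last
  · intro i hi
    have a1 : i < p.n + 1 := by omega
    have a2 : i + 1 < p.n + 1 := by omega
    simp only [hi, a1, a2, dif_pos]
    exact p.valid ⟨i, hi⟩
  · intro j h0 hn
    have a1 : j < p.n + 1 := by omega
    have a2 : j - 1 < p.n := by omega
    simp only [hn, a1, a2, dif_pos]
    exact ⟨(hc j h0 hn).1, (hc j h0 hn).2, hP j h0 hn⟩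
  · intro i
    exact dif_pos i.2

theorem NatW.toD {V : Type} {dir bi : V → V → Prop} {P : V → Prop} {u v : V}
    {n : ℕ} {f : ℕ → V} {k : ℕ → EKind} (h : NatW dir bi P u v n f k)
    (hinj : ∀ i j, i < j → j ≤ n → f i ≠ f j) :
    ∃ p : DWalk dir bi u v, Function.Injective p.vert ∧ p.AllColliders ∧
      ∀ (j : ℕ) (_h0 : 0 < j) (hn : j < p.n), P (p.vert ⟨j, Nat.lt_succ_of_lt hn⟩) := by
  obtain ⟨h1, h2, h3, h4⟩ := h
  refine ⟨⟨n, fun i => f i, by simpa using h1, by simpa using h2, fun i => k i,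
    fun i => by simpa using h3 i i.2⟩, ?_, ?_, ?_⟩
  · intro a b hab
    rcases lt_trichotomy a b with hl | hl | hl
    · exact absurd hab (hinj a b hl (Nat.lt_succ_iff.1 b.2))
    · exact hl
    · exact absurd hab.symm (hinj b a hl (Nat.lt_succ_iff.1 a.2))
  · intro j h0 hn
    exact ⟨(h4 j h0 hn).1, (h4 j h0 hn).2.1⟩
  · intro j h0 hn
    exact (h4 j h0 hn).2.2

/-- Vertex projection. -/
def projV (κ : ι → γ) : MVert ι → CMVert γ ι
  | .var x => .cl (κ x)
  | .ind x => .rcl (κ x)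
  | .proxy x => .proxy x

theorem projV_dir (G : mADMG ι) (κ : ι → γ) (u v : MVert ι) (h : G.dir u v) :
    inducedCMdir G κ (projV κ u) (projV κ v) := by
  rcases u with x | x | x <;> rcases v with y | y | y
  · exact ⟨x, y, rfl, rfl, h⟩
  · exact ⟨x, y, rfl, rfl, h⟩
  · have := (G.proxy_parents y _).1 h
    simp at this
    obtain ⟨h1, rfl⟩ := this
    exact ⟨rfl, h1⟩
  · exact absurd (G.ind_children _ _ h) (by simp)
  · exact absurd h (G.ind_no_ind_dir _ _)
  · have := (G.proxy_parents y _).1 h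
    simp at this
    obtain ⟨h1, rfl⟩ := this
    exact ⟨rfl, h1⟩
  all_goals exact absurd h (G.proxy_no_children _ _)

theorem projV_bi (G : mADMG ι) (κ : ι → γ) (u v : MVert ι) (h : G.bi u v) :
    inducedCMbi G κ (projV κ u) (projV κ v) := by
  rcases u with x | x | x <;> rcases v with y | y | y
  · exact ⟨x, y, rfl, rfl, Or.inl h⟩
  · exact ⟨x, y, rfl, rfl, Or.inl h⟩
  · exact absurd h (G.proxy_no_bi _ _).2
  · exact ⟨y, x, rfl, rfl, Or.inr h⟩
  · exact absurd h (G.ind_no_ind_bi _ _)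
  · exact absurd h (G.proxy_no_bi _ _).2
  all_goals exact absurd h (G.proxy_no_bi _ _).1

/-- Directed edges of the saturated graph. -/
def satDir (G : mADMG ι) (κ : ι → γ) (σ : ι → ι) : MVert ι → MVert ι → Prop
  | .var x, .var y => G.dir (.var (σ x)) (.var (σ y))
  | .var x, .ind y => y ∈ G.Vm ∧ inducedCMdir G κ (.cl (κ x)) (.rcl (κ y))
  | .var x, .proxy y => y ∈ G.Vm ∧ x = y
  | .ind x, .proxy y => y ∈ G.Vm ∧ x = y
  | _, _ => False

/-- Bidirected edges of the saturated graph. -/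
def satBi (G : mADMG ι) (κ : ι → γ) : MVert ι → MVert ι → Prop
  | .var x, .var y => x ≠ y ∧ inducedCMbi G κ (.cl (κ x)) (.cl (κ y))
  | .var x, .ind y => y ∈ G.Vm ∧ inducedCMbi G κ (.cl (κ x)) (.rcl (κ y))
  | _, _ => False

theorem satDir_acyc (G : mADMG ι) (κ : ι → γ) (σ : ι → ι) (u v : MVert ι)
    (h : Relation.TransGen (satDir G κ σ) u v) :
    match u, v with
    | .var a, .var b => Relation.TransGen G.dir (.var (σ a)) (.var (σ b))
    | .var _, _ => True
    | .ind _, .proxy _ => True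
    | _, _ => False := by
  induction h with
  | single h => 
    rename_i b
    rcases u with x | x | x <;> rcases b with y | y | y <;>
      first | exact Relation.TransGen.single h | trivial | exact False.elim h
  | tail h1 h2 ih =>
    rename_i b d
    rcases u with x | x | x <;> rcases b with y | y | y <;> rcases d with z | z | z <;>
      first | exact Relation.TransGen.tail ih h2 | trivial | exact False.elim h2 | exact False.elim ih

/-- The saturated graph. -/
def satG (G : mADMG ι) (κ : ι → γ) (σ : ι → ι) : mADMG ι where
  Vm := G.Vm
  dir := satDir G κ σ
  bi := satBi G κ
  acyclic := by
    intro v h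
    have := satDir_acyc G κ σ v v h
    rcases v with x | x | x
    · exact G.acyclic _ this
    · exact this
    · exact this
  bi_ne := by
    intro u v h
    rcases u with x | x | x <;> rcases v with y | y | y <;> simp_all [satBi]
  mem_dir := by
    intro u v h
    rcases u with x | x | x <;> rcases v with y | y | y <;> simp_all [satDir, MVert.ok]
  mem_bi := by
    intro u v h
    rcases u with x | x | x <;> rcases v with y | y | y <;> simp_all [satBi, MVert.ok]
  proxy_no_children := by
    intro x v h
    rcases v with y | y | y <;> simp_all [satDir]
  proxy_no_bi := by
    intro x v
    rcases v with y | y | y <;> simp_all [satBi]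
  proxy_parents := by
    intro x v
    rcases v with y | y | y <;> simp_all [satDir]
  ind_no_ind_dir := by
    intro x y h
    exact h
  ind_no_ind_bi := by
    intro x y h
    exact h
  ind_children := by
    intro x v h
    rcases v with y | y | y <;> simp_all [satDir]

theorem satG_induced (G : mADMG ι) (κ : ι → γ) (σ : ι → ι) (hσ : ∀ x, σ (σ x) = x)
    (hκσ : ∀ x, κ (σ x) = κ x) : inducedCM (satG G κ σ) κ = inducedCM G κ := by
  have e1 : inducedCMdir (satG G κ σ) κ = inducedCMdir G κ := by
    funext u v
    apply propext
    rcases u with x | x | x <;> rcases v with y | y | y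
    · constructor
      · rintro ⟨a, b, rfl, rfl, h⟩
        exact ⟨σ a, σ b, hκσ a, hκσ b, h⟩
      · rintro ⟨a, b, rfl, rfl, h⟩
        refine ⟨σ a, σ b, hκσ a, hκσ b, ?_⟩
        show G.dir (.var (σ (σ a))) (.var (σ (σ b)))
        rwa [hσ, hσ]
    · constructor
      · rintro ⟨a, b, rfl, rfl, h⟩
        exact h.2
      · rintro ⟨a, b, rfl, rfl, h⟩
        exact ⟨a, b, rfl, rfl, (G.mem_dir _ _ h).2, a, b, rfl, rfl, h⟩
    all_goals exact Iff.rfl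
  have e2 : inducedCMbi (satG G κ σ) κ = inducedCMbi G κ := by
    have key : ∀ x y, inducedCMbi (satG G κ σ) κ (.cl x) (.rcl y)
        ↔ inducedCMbi G κ (.cl x) (.rcl y) := by
      intro x y
      constructor
      · rintro ⟨a, b, rfl, rfl, h | h⟩
        · exact h.2
        · exact h.elim
      · rintro ⟨a, b, rfl, rfl, h⟩
        refine ⟨a, b, rfl, rfl, Or.inl ⟨?_, a, b, rfl, rfl, h⟩⟩
        rcases h with h | h
        · exact (G.mem_bi _ _ h).2
        · exact (G.mem_bi _ _ h).1
    funext u v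
    apply propext
    rcases u with x | x | x <;> rcases v with y | y | y
    · constructor
      · rintro ⟨a, b, rfl, rfl, h | h⟩
        · exact h.2
        · obtain ⟨a', b', h1, h2, h3⟩ := h.2
          exact ⟨b', a', h2, h1, h3.symm⟩
      · rintro ⟨a, b, rfl, rfl, h⟩
        refine ⟨a, b, rfl, rfl, Or.inl ⟨?_, a, b, rfl, rfl, h⟩⟩
        rintro rfl
        rcases h with h | h <;> exact G.bi_ne _ _ h rfl
    · exact key x y
    · exact Iff.rfl
    · exact key y x
    all_goals exact Iff.rfl
  unfold inducedCM
  rw [e1, e2]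
  rfl

/-- Lifting of vertices along a section. -/
def liftV (s : γ → ι) : CMVert γ ι → MVert ι
  | .cl d => .var (s d)
  | .rcl d => .ind (s d)
  | .proxy x => .proxy x

theorem liftV_inj (s : γ → ι) (hs : Function.Injective s) : Function.Injective (liftV s) := by
  intro u v h
  rcases u with x | x | x <;> rcases v with y | y | y <;> simp_all [liftV] <;> exact hs h

theorem lift_path (G : mADMG ι) (κ : ι → γ) (c : γ) (σ : ι → ι)
    (s : γ → ι) (hs : ∀ d, κ (s d) = d) (hx : s c ∈ G.Vm)
    (n : ℕ) (f : ℕ → CMVert γ ι) (k : ℕ → EKind)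
    (h : NatW (inducedCMdir G κ) (inducedCMbi G κ) (fun v => ∃ d, v = .cl d)
      (.cl c) (.rcl c) n f k)
    (hinj : ∀ i j, i < j → j ≤ n → f i ≠ f j)
    (hd : 1 < n → k 0 = .fwd → ∀ d, f 1 = .cl d →
      G.dir (.var (σ (s c))) (.var (σ (s d)))) :
    NatW (satG G κ σ).dir (satG G κ σ).bi (fun v => ∃ y, v = .var y)
      (.var (s c)) (.ind (s c)) n (fun i => liftV s (f i)) k := by
  obtain ⟨h1, h2, h3, h4⟩ := h
  have hsi : Function.Injective s := fun a b hab => by rw [← hs a, hab, hs b]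
  have hcl : ∀ i, i < n → ∃ d, f i = .cl d := by
    intro i hi
    rcases Nat.eq_zero_or_pos i with rfl | h0
    · exact ⟨c, h1⟩
    · exact (h4 i h0 hi).2.2
  have hbi : ∀ d v, (v = .rcl c ∨ ∃ e, v = .cl e) → CMVert.cl d ≠ v →
      inducedCMbi G κ (.cl d) v → satBi G κ (.var (s d)) (liftV s v) := by
    rintro d v (rfl | ⟨e, rfl⟩) hne hb
    · refine ⟨hx, ?_⟩
      rw [hs, hs]; exact hb
    · refine ⟨fun he => hne (by rw [hsi he]), ?_⟩
      rw [hs, hs]; exact hb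
  have hsymm : ∀ u v, inducedCMbi G κ u v → inducedCMbi G κ v u := by
    intro u v hb
    rcases u with x | x | x <;> rcases v with y | y | y
    · obtain ⟨a', b', h1, h2, h3⟩ := hb
      exact ⟨b', a', h2, h1, h3.symm⟩
    all_goals exact hb
  refine ⟨by simp only [h1]; rfl, by simp only [h2]; rfl, ?_, ?_⟩
  · intro i hi
    obtain ⟨d, hdi⟩ := hcl i hi
    have hnext : f (i+1) = .rcl c ∨ ∃ e, f (i+1) = .cl e := by
      rcases Nat.lt_or_ge (i+1) n with hl | hl
      · exact Or.inr (hcl _ hl)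
      · left
        have : i + 1 = n := by omega
        rw [this, h2]
    obtain ⟨v1, v2, v3⟩ := h3 i hi
    refine ⟨?_, ?_, ?_⟩
    · intro hk
      have hi0 : i = 0 := by
        by_contra h0
        exact (h4 i (by omega) hi).2.1 hk
      subst hi0
      have hdir := v1 hk
      have hd' : f 0 = .cl c := h1
      rcases Nat.lt_or_ge 1 n with hl | hl
      · obtain ⟨e, he⟩ := hcl 1 hl
        simp only [hd', zero_add, he]
        exact hd hl hk e he
      · have hn1 : n = 1 := by omega
        subst hn1
        simp only [hd', zero_add, h2] at hdir ⊢
        refine ⟨hx, ?_⟩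
        rw [hs]; exact hdir
    · intro hk
      exfalso
      have hl : i + 1 = n := by
        by_contra hl
        exact (h4 (i+1) (by omega) (by omega)).1 hk
      have hdir := v2 hk
      rw [hl, h2, hdi] at hdir
      exact hdir
    · intro hk
      left
      have hb : inducedCMbi G κ (f i) (f (i+1)) := by
        rcases v3 hk with hb | hb
        · exact hb
        · exact hsymm _ _ hb
      have hne := hinj i (i+1) (by omega) (by omega)
      simp only [hdi] at hb hne ⊢
      exact hbi d _ hnext hne hb
  · intro j h0 hn
    refine ⟨(h4 j h0 hn).1, (h4 j h0 hn).2.1, ?_⟩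
    obtain ⟨d, hdj⟩ := hcl j hn
    exact ⟨s d, by simp only [hdj]; rfl⟩

/-- Let `Gcm` be a cm-C-DMG over a partition into nonempty
clusters (`κ` surjective), `c` a cluster containing a partially observed
variable, and assume some m-ADMG is compatible with `Gcm`.  Then: `Gcm`
contains a path between the cluster `c` and its cluster-level missingness
vertex `R_c` all of whose intermediate vertices are colliders on the path and
are cluster vertices, if and only if there exists an m-ADMG compatible with
`Gcm` that contains a path between some partially observed variable `x` of the
cluster `c` and its missingness indicator `R_x` all of whose intermediate
vertices are colliders on the path and are substantive variables. -/
theorem cluster_collider_path_iff_exists_compatible_collider_path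
    {ι γ : Type} (κ : ι → γ) (hκ : Function.Surjective κ)
    (Gcm : ClusterCM γ ι) (c : γ) (hc : ∃ x ∈ Gcm.Vm, κ x = c)
    (hex : ∃ G : mADMG ι, inducedCM G κ = Gcm) :
    (∃ p : DWalk Gcm.dir Gcm.bi (CMVert.cl c) (CMVert.rcl c),
        Function.Injective p.vert ∧ p.AllColliders ∧
        ∀ (j : ℕ) (_h0 : 0 < j) (hn : j < p.n),
          ∃ d : γ, p.vert ⟨j, Nat.lt_succ_of_lt hn⟩ = CMVert.cl d) ↔
      (∃ G : mADMG ι, inducedCM G κ = Gcm ∧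
        ∃ x ∈ Gcm.Vm, κ x = c ∧
          ∃ q : DWalk G.dir G.bi (MVert.var x) (MVert.ind x),
            Function.Injective q.vert ∧ q.AllColliders ∧
            ∀ (j : ℕ) (_h0 : 0 < j) (hn : j < q.n),
              ∃ y : ι, q.vert ⟨j, Nat.lt_succ_of_lt hn⟩ = MVert.var y) := by
  classical
  obtain ⟨G, rfl⟩ := hex
  constructor
  · rintro ⟨p, hpi, hpc, hpP⟩
    obtain ⟨f, k, hw, hf⟩ := NatW.ofD (P := fun v => ∃ d, v = CMVert.cl d) p hpc hpP
    have hinj : ∀ i j, i < j → j ≤ p.n → f i ≠ f j := by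
      intro i j hij hj he
      have e1 := hf ⟨i, by omega⟩
      have e2 := hf ⟨j, by omega⟩
      simp only at e1 e2
      rw [e1, e2] at he
      have := congrArg Fin.val (hpi he)
      simp only at this
      omega
    obtain ⟨x1, hx1, hx1c⟩ := hc
    have hx1' : x1 ∈ G.Vm := hx1
    obtain ⟨σ, s, hσ, hκσ, hs, hsc, hd⟩ : ∃ (σ : ι → ι) (s : γ → ι), (∀ x, σ (σ x) = x) ∧
        (∀ x, κ (σ x) = κ x) ∧ (∀ d, κ (s d) = d) ∧ s c = x1 ∧
        (1 < p.n → k 0 = .fwd → ∀ d, f 1 = .cl d →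
          G.dir (.var (σ (s c))) (.var (σ (s d)))) := by
      by_cases hcase : 1 < p.n ∧ k 0 = .fwd
      · obtain ⟨hn1, hk0⟩ := hcase
        obtain ⟨h1, h2, h3, h4⟩ := hw
        obtain ⟨d, hd⟩ := (h4 1 (by omega) hn1).2.2
        have hdir := (h3 0 (by omega)).1 hk0
        simp only [zero_add, hd, h1] at hdir
        obtain ⟨x0, y0, hx0, hy0, hxy⟩ := hdir
        have hne : c ≠ d := by
          rintro rfl
          exact hinj 0 1 (by omega) (by omega) (by rw [h1, hd])
        refine ⟨Equiv.swap x0 x1,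
          Function.update (Function.update (Function.surjInv hκ) d y0) c x1, ?_, ?_, ?_, ?_, ?_⟩
        · intro x; simp
        · intro x
          rcases eq_or_ne x x0 with rfl | hh0
          · rw [Equiv.swap_apply_left, hx1c, hx0]
          · rcases eq_or_ne x x1 with rfl | hh1
            · rw [Equiv.swap_apply_right, hx1c, hx0]
            · rw [Equiv.swap_apply_of_ne_of_ne hh0 hh1]
        · intro e
          rcases eq_or_ne e c with rfl | hec
          · simpa using hx1c
          · rw [Function.update_of_ne hec]
            rcases eq_or_ne e d with rfl | hed
            · simpa using hy0
            · rw [Function.update_of_ne hed]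
              exact Function.surjInv_eq hκ e
        · simp
        · intro _ _ e he
          rw [hd] at he
          cases he
          rw [Function.update_self, Function.update_of_ne hne.symm, Function.update_self,
            Equiv.swap_apply_right, Equiv.swap_apply_of_ne_of_ne]
          · exact hxy
          · rintro rfl
            exact hne (hx0.symm.trans hy0)
          · rintro rfl
            exact hne (hx1c.symm.trans hy0)
      · refine ⟨id, Function.update (Function.surjInv hκ) c x1, fun _ => rfl, fun _ => rfl,
          ?_, by simp, fun a b => absurd ⟨a, b⟩ hcase⟩
        intro e
        rcases eq_or_ne e c with rfl | hec
        · simpa using hx1c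
        · rw [Function.update_of_ne hec]
          exact Function.surjInv_eq hκ e
    have hL := lift_path G κ c σ s hs (by rw [hsc]; exact hx1') p.n f k hw hinj hd
    have hsi : Function.Injective s := fun a b hab => by rw [← hs a, hab, hs b]
    refine ⟨satG G κ σ, satG_induced G κ σ hσ hκσ, s c, by rw [hsc]; exact hx1, hs c, ?_⟩
    exact hL.toD (fun i j hij hj he => hinj i j hij hj (liftV_inj s hsi he))
  · rintro ⟨G', hG', x, hx, hxc, q, hqi, hqc, hqP⟩
    rw [← hG']
    obtain ⟨f, k, ⟨h1, h2, h3, h4⟩, -⟩ :=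
      NatW.ofD (P := fun v => ∃ d, v = MVert.var d) q hqc hqP
    have hw : NatW (inducedCM G' κ).dir (inducedCM G' κ).bi (fun v => ∃ d, v = CMVert.cl d)
        (.cl c) (.rcl c) q.n (fun i => projV κ (f i)) k := by
      refine ⟨by simp only [h1, ← hxc]; rfl, by simp only [h2, ← hxc]; rfl, ?_, ?_⟩
      · intro i hi
        obtain ⟨v1, v2, v3⟩ := h3 i hi
        exact ⟨fun hk => projV_dir _ _ _ _ (v1 hk), fun hk => projV_dir _ _ _ _ (v2 hk),
          fun hk => (v3 hk).imp (projV_bi _ _ _ _) (projV_bi _ _ _ _)⟩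
      · intro j h0 hn
        obtain ⟨a, b, d, hd⟩ := h4 j h0 hn
        exact ⟨a, b, κ d, by simp only [hd]; rfl⟩
    obtain ⟨n', f', k', hw', hinj'⟩ := NatW.toInj _ _ _ hw
    exact hw'.toD hinj'
end

section
/- Let (Ω, ℱ, P) be a probability space, α and β measurable spaces, V_m : Ω → α and V_o : Ω → β measurable random variables, and R : Ω → Bool a measurable missingness indicator. Suppose R and V_m are conditionally independent given the σ-algebra generated by V_o (the MAR condition). Then for every measurable set A ⊆ α and every b ∈ β such that {b} is measurable and P(V_o = b, R = 0) > 0, one has P(V_m ∈ A | V_o = b) = P(V_m ∈ A | V_o = b, R = 0), where each side is the conditional probability measure given the corresponding positive-probability event. -/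
open MeasureTheory ProbabilityTheory

lemma mar_aux {Ω : Type*} [mΩ : MeasurableSpace Ω]
    (P : Measure Ω) [IsProbabilityMeasure P]
    {β : Type*} [MeasurableSpace β] (Vo : Ω → β) (hVo : Measurable Vo)
    (b : β) (hb : MeasurableSet ({b} : Set β)) {S : Set Ω} (hS : MeasurableSet S)
    (ω : Ω) (hω : Vo ω = b) :
    P.real ({ω | Vo ω = b} ∩ S) =
      (P⟦S | MeasurableSpace.comap Vo inferInstance⟧) ω * P.real {ω | Vo ω = b} := by
  have hB : MeasurableSet {ω | Vo ω = b} := hVo hb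
  have h := setIntegral_condExp (μ := P) hVo.comap_le
    (f := S.indicator (fun _ => (1 : ℝ))) ((integrable_const _).indicator hS)
    (s := {ω | Vo ω = b}) ⟨{b}, hb, rfl⟩
  have hc : ∀ x ∈ {ω | Vo ω = b},
      (P⟦S | MeasurableSpace.comap Vo inferInstance⟧) x =
      (P⟦S | MeasurableSpace.comap Vo inferInstance⟧) ω := by
    intro x hx
    have hg : Measurable[MeasurableSpace.comap Vo inferInstance]
      (P⟦S | MeasurableSpace.comap Vo inferInstance⟧) := stronglyMeasurable_condExp.measurable
    obtain ⟨t, -, ht⟩ := hg (measurableSet_singleton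
      ((P⟦S | MeasurableSpace.comap Vo inferInstance⟧) ω))
    have h1 : ω ∈ Vo ⁻¹' t := by rw [ht]; rfl
    have h2 : x ∈ Vo ⁻¹' t := by
      have hx' : Vo x = b := hx
      simpa [hx', hω] using h1
    rw [ht] at h2
    exact h2
  rw [setIntegral_congr_fun hB hc, setIntegral_indicator hS] at h
  simp at h
  rw [← h, mul_comm]

/-- MAR: conditioning on complete cases does not change the
conditional distribution.
Let `P` be a probability measure on `Ω`, `Vm : Ω → α` and `Vo : Ω → β`
measurable random variables, and `R : Ω → Bool` a measurable missingness
indicator (with `R ω = false` meaning "observed").  If `R` and `Vm` are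
conditionally independent given the σ-algebra generated by `Vo` (MAR), then for
every measurable `A ⊆ α` and every `b : β` with `{b}` measurable and
`P(Vo = b, R = 0) > 0`, we have
`P(Vm ∈ A | Vo = b) = P(Vm ∈ A | Vo = b, R = 0)`. -/
theorem mar_cond_eq {Ω : Type*} [mΩ : MeasurableSpace Ω] [StandardBorelSpace Ω]
    [Nonempty Ω] (P : Measure Ω) [IsProbabilityMeasure P]
    {α β : Type*} [MeasurableSpace α] [MeasurableSpace β]
    (Vm : Ω → α) (Vo : Ω → β) (R : Ω → Bool)
    (hVm : Measurable Vm) (hVo : Measurable Vo) (hR : Measurable R)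
    (hMAR : CondIndepFun (MeasurableSpace.comap Vo inferInstance) hVo.comap_le
      R Vm P)
    (A : Set α) (hA : MeasurableSet A)
    (b : β) (hb : MeasurableSet ({b} : Set β))
    (hpos : 0 < P ({ω | Vo ω = b} ∩ {ω | R ω = false})) :
    ProbabilityTheory.cond P {ω | Vo ω = b} (Vm ⁻¹' A) =
      ProbabilityTheory.cond P ({ω | Vo ω = b} ∩ {ω | R ω = false})
        (Vm ⁻¹' A) := by
  have hB : MeasurableSet {ω | Vo ω = b} := hVo hb
  have hS : MeasurableSet (R ⁻¹' {false}) := hR (MeasurableSet.singleton _)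
  have hT : MeasurableSet (Vm ⁻¹' A) := hVm hA
  have hBpos : 0 < P {ω | Vo ω = b} := hpos.trans_le (measure_mono Set.inter_subset_left)
  have h1 := (condIndepFun_iff_condExp_inter_preimage_eq_mul hR hVm).1 hMAR {false} A
    (MeasurableSet.singleton _) hA
  obtain ⟨ω, hω, h2⟩ := ((frequently_ae_iff (p := fun ω => Vo ω = b)).2
    hBpos.ne').and_eventually h1 |>.exists
  have e1 := mar_aux P Vo hVo b hb (hS.inter hT) ω hω
  have e2 := mar_aux P Vo hVo b hb hS ω hω
  have e3 := mar_aux P Vo hVo b hb hT ω hω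
  have hSe : {ω | R ω = false} = R ⁻¹' {false} := rfl
  rw [hSe] at hpos ⊢
  have p1 : P.real {ω | Vo ω = b} ≠ 0 := (ENNReal.toReal_pos hBpos.ne' (measure_ne_top _ _)).ne'
  have p2 : P.real ({ω | Vo ω = b} ∩ R ⁻¹' {false}) ≠ 0 :=
    (ENNReal.toReal_pos hpos.ne' (measure_ne_top _ _)).ne'
  rw [← ENNReal.toReal_eq_toReal_iff' (measure_ne_top _ _) (measure_ne_top _ _)]
  rw [cond_apply hB, cond_apply (hB.inter hS), Set.inter_assoc]
  simp only [ENNReal.toReal_mul, ENNReal.toReal_inv, ← measureReal_def]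
  rw [e1, e3]
  rw [e2] at p2 ⊢
  simp only [h2]
  have p3 := left_ne_zero_of_mul p2
  field_simp
end
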